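/- arXiv:1008.0490 — 6 statements merged into one kernel-verified Lean document; each statement's English description precedes it below -/
import Mathlib

section
/- If v : ℝ → ℝ is a positive, twice continuously differentiable function satisfying the Delaunay ODE h_v(t)^{k−1}·(v(t) − α⁻²v″(t)) = (n/(n−2k))·v(t)^{q−1} at every t ∈ ℝ, then the Hamiltonian energy H_v(t) = h_v(t)^k − v(t)^q is constant in t; i.e. H_v(t) = H_v(0) for all t ∈ ℝ. -/
noncomputable section

open Real Set

/-- α = (n−2k)/(2k) -/
def alp (n k : ℕ) : ℝ := ((n : ℝ) - 2 * (k : ℝ)) / (2 * (k : ℝ))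

/-- q = 2kn/(n−2k) -/
def qe (n k : ℕ) : ℝ := (2 * (k : ℝ) * (n : ℝ)) / ((n : ℝ) - 2 * (k : ℝ))

/-- h_v(t) = v(t)² − α⁻² v′(t)² -/
def hDel (n k : ℕ) (v : ℝ → ℝ) (t : ℝ) : ℝ :=
  (v t) ^ 2 - ((alp n k)⁻¹) ^ 2 * (deriv v t) ^ 2

/-- H_v(t) = h_v(t)^k − v(t)^q -/
def HDel (n k : ℕ) (v : ℝ → ℝ) (t : ℝ) : ℝ :=
  (hDel n k v t) ^ k - (v t) ^ (qe n k)

/-- The Delaunay ODE. -/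
def DelODE (n k : ℕ) (v : ℝ → ℝ) : Prop :=
  ∀ t : ℝ, (hDel n k v t) ^ (k - 1) * (v t - ((alp n k)⁻¹) ^ 2 * deriv (deriv v) t)
    = ((n : ℝ) / ((n : ℝ) - 2 * (k : ℝ))) * (v t) ^ (qe n k - 1)

/-- H_max = (2k/(n−2k))·((n−2k)/n)^{n/(2k)} -/
def Hmax (n k : ℕ) : ℝ :=
  (2 * (k : ℝ) / ((n : ℝ) - 2 * (k : ℝ))) *
    (((n : ℝ) - 2 * (k : ℝ)) / (n : ℝ)) ^ ((n : ℝ) / (2 * (k : ℝ)))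

/-- A Delaunay solution with parameter H₀. -/
def DelSol (n k : ℕ) (H₀ : ℝ) (v : ℝ → ℝ) : Prop :=
  ContDiff ℝ (⊤ : ℕ∞) v ∧ (∀ t, 0 < v t) ∧ DelODE n k v ∧
    deriv v 0 = 0 ∧ 0 < deriv (deriv v) 0 ∧ ∀ t, HDel n k v t = H₀

/-- F(t) = v(t)^q/(H₀ + v(t)^q) -/
def FDel (n k : ℕ) (H₀ : ℝ) (v : ℝ → ℝ) (t : ℝ) : ℝ :=
  (v t) ^ (qe n k) / (H₀ + (v t) ^ (qe n k))

/-- The coefficient a(t) of the conjugate linearized operator. -/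
def aDel (n k : ℕ) (H₀ : ℝ) (v : ℝ → ℝ) (t : ℝ) : ℝ :=
  ((n : ℝ) - (k : ℝ)) / ((k : ℝ) * ((n : ℝ) - 1)) +
    ((n : ℝ) * ((k : ℝ) - 1) / ((k : ℝ) * ((n : ℝ) - 1))) * FDel n k H₀ v t

/-- The potential p(t) of the conjugate linearized operator. -/
def pDel (n k : ℕ) (H₀ : ℝ) (v : ℝ → ℝ) (t : ℝ) : ℝ :=
  (alp n k) ^ 2
  + ((n : ℝ) * ((n : ℝ) * (k : ℝ) + (n : ℝ) - 2 * (k : ℝ)) * ((k : ℝ) - 1) /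
      (2 * (k : ℝ) ^ 2)) * FDel n k H₀ v t
  - ((n : ℝ) ^ 2 * ((k : ℝ) ^ 2 - 1) / (4 * (k : ℝ) ^ 2)) * (FDel n k H₀ v t) ^ 2
  - ((n : ℝ) * (2 * (k : ℝ) * (n : ℝ) - (n : ℝ) + 2 * (k : ℝ)) / (4 * (k : ℝ))) *
      (v t) ^ (4 * (k : ℝ) / ((n : ℝ) - 2 * (k : ℝ))) *
      (FDel n k H₀ v t) ^ (((k : ℝ) - 1) / (k : ℝ))
  + ((n : ℝ) ^ 2 * (k : ℝ) * ((k : ℝ) - 1) / (4 * (k : ℝ) ^ 2)) *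
      (v t) ^ (4 * (k : ℝ) / ((n : ℝ) - 2 * (k : ℝ))) *
      (FDel n k H₀ v t) ^ ((2 * (k : ℝ) - 1) / (k : ℝ))
/-- The Hamiltonian energy of a positive `C²` function has zero derivative along the Delaunay ODE. -/
theorem hasDerivAt_HDel_zero {n k : ℕ} {v : ℝ → ℝ} (hpos : ∀ t, 0 < v t)
    (hreg : ContDiff ℝ 2 v) (hode : DelODE n k v) (t : ℝ) :
    HasDerivAt (HDel n k v) 0 t := by
  have hv : HasDerivAt v (deriv v t) t :=
    (hreg.differentiable (by norm_num)).differentiableAt.hasDerivAt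
  have hv' : HasDerivAt (deriv v) (deriv (deriv v) t) t :=
    (hreg.differentiable_deriv_two t).hasDerivAt
  have hh : HasDerivAt (hDel n k v)
      (2 * deriv v t * (v t - ((alp n k)⁻¹) ^ 2 * deriv (deriv v) t)) t := by
    refine ((hv.pow 2).sub ((hv'.pow 2).const_mul (((alp n k)⁻¹) ^ 2))).congr_deriv ?_
    push_cast
    ring
  refine ((hh.pow k).sub (hv.rpow_const (p := qe n k) (Or.inl (hpos t).ne'))).congr_deriv ?_
  have hq : qe n k = 2 * (k : ℝ) * ((n : ℝ) / ((n : ℝ) - 2 * (k : ℝ))) := by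
    rw [qe, mul_div_assoc]
  linear_combination 2 * (k : ℝ) * deriv v t * hode t
    - deriv v t * v t ^ (qe n k - 1) * hq

/-- conservation of the Hamiltonian energy along the Delaunay ODE. -/
theorem hamiltonian_conserved (n k : ℕ) (hk : 2 ≤ 2 * k) (hkn : 2 * k < n)
    (v : ℝ → ℝ) (hpos : ∀ t, 0 < v t) (hreg : ContDiff ℝ 2 v)
    (hode : DelODE n k v) :
    ∀ t : ℝ, HDel n k v t = HDel n k v 0 := by
  intro t
  have hderiv := hasDerivAt_HDel_zero hpos hreg hode
  exact is_const_of_deriv_eq_zero (fun s => (hderiv s).differentiableAt)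
    (fun s => (hderiv s).deriv) t 0
end
end

section
/- For every H₀ with 0 < H₀ < H_max, the equation s^{2k} − s^q = H₀ has exactly two solutions s in (0, ∞); both solutions lie in the open interval (0, 1), one of them lies in (0, s*) and the other in (s*, 1), where s* := ((n−2k)/n)^{(n−2k)/(4k²)}. -/
noncomputable section

open Real Set

lemma hasDerivAt_rpow_sub_rpow (a b : ℝ) {s : ℝ} (hs : 0 < s) :
    HasDerivAt (fun s : ℝ => s ^ a - s ^ b) (s ^ (a - 1) * (a - b * s ^ (b - a))) s := by
  have h := (Real.hasDerivAt_rpow_const (p := a) (Or.inl hs.ne')).sub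
    (Real.hasDerivAt_rpow_const (p := b) (Or.inl hs.ne'))
  have he : s ^ (a - 1) * (a - b * s ^ (b - a)) = a * s ^ (a - 1) - b * s ^ (b - 1) := by
    rw [mul_sub, mul_left_comm, ← Real.rpow_add hs]
    ring_nf
  rw [he]
  exact h

lemma continuous_rpow_sub_rpow {a b : ℝ} (ha : 0 ≤ a) (hb : 0 ≤ b) :
    Continuous (fun s : ℝ => s ^ a - s ^ b) :=
  (Real.continuous_rpow_const ha).sub (Real.continuous_rpow_const hb)

lemma strictMonoOn_rpow_sub_rpow {a b c : ℝ} (ha : 0 < a) (hab : a < b)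
    (hc : b * c ^ (b - a) = a) :
    StrictMonoOn (fun s : ℝ => s ^ a - s ^ b) (Set.Icc 0 c) := by
  have hb := ha.trans hab
  refine strictMonoOn_of_deriv_pos (convex_Icc 0 c)
    (continuous_rpow_sub_rpow ha.le hb.le).continuousOn fun s hs => ?_
  rw [interior_Icc] at hs
  rw [(hasDerivAt_rpow_sub_rpow a b hs.1).deriv]
  have hlt := Real.rpow_lt_rpow hs.1.le hs.2 (sub_pos.2 hab)
  exact mul_pos (Real.rpow_pos_of_pos hs.1 _)
    (sub_pos.2 ((mul_lt_mul_of_pos_left hlt hb).trans_eq hc))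

lemma strictAntiOn_rpow_sub_rpow {a b c : ℝ} (ha : 0 < a) (hab : a < b) (hc₀ : 0 < c)
    (hc : b * c ^ (b - a) = a) :
    StrictAntiOn (fun s : ℝ => s ^ a - s ^ b) (Set.Ici c) := by
  have hb := ha.trans hab
  refine strictAntiOn_of_deriv_neg (convex_Ici c)
    (continuous_rpow_sub_rpow ha.le hb.le).continuousOn fun s hs => ?_
  rw [interior_Ici] at hs
  have hs₀ : 0 < s := hc₀.trans hs
  rw [(hasDerivAt_rpow_sub_rpow a b hs₀).deriv]
  have hlt := Real.rpow_lt_rpow hc₀.le hs (sub_pos.2 hab)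
  exact mul_neg_of_pos_of_neg (Real.rpow_pos_of_pos hs₀ _)
    (sub_neg.2 (hc.symm.trans_lt (mul_lt_mul_of_pos_left hlt hb)))

/-- Below its maximum over the positive reals, attained at `c`, the function `s ^ a - s ^ b`
takes each positive value exactly twice. -/
lemma exists_two_solutions_rpow_sub_rpow {a b c H : ℝ} (ha : 0 < a) (hab : a < b)
    (hc₀ : 0 < c) (hc₁ : c < 1) (hc : b * c ^ (b - a) = a) (hH₀ : 0 < H)
    (hH : H < c ^ a - c ^ b) :
    ∃ s₁ s₂ : ℝ, s₁ ∈ Set.Ioo 0 c ∧ s₂ ∈ Set.Ioo c 1 ∧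
      s₁ ^ a - s₁ ^ b = H ∧ s₂ ^ a - s₂ ^ b = H ∧
      ∀ s : ℝ, 0 < s → s ^ a - s ^ b = H → s = s₁ ∨ s = s₂ := by
  have hb := ha.trans hab
  have hcont := continuous_rpow_sub_rpow ha.le hb.le
  obtain ⟨s₁, hs₁, h₁⟩ := intermediate_value_Ioo hc₀.le hcont.continuousOn
    (show H ∈ Set.Ioo _ _ from
      ⟨by simpa [Real.zero_rpow ha.ne', Real.zero_rpow hb.ne'] using hH₀, hH⟩)
  obtain ⟨s₂, hs₂, h₂⟩ := intermediate_value_Ioo' hc₁.le hcont.continuousOn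
    (show H ∈ Set.Ioo _ _ from ⟨by simpa using hH₀, hH⟩)
  refine ⟨s₁, s₂, hs₁, hs₂, h₁, h₂, fun s hs h => ?_⟩
  rcases le_total s c with hsc | hsc
  · exact Or.inl ((strictMonoOn_rpow_sub_rpow ha hab hc).injOn ⟨hs.le, hsc⟩
      ⟨hs₁.1.le, hs₁.2.le⟩ (h.trans h₁.symm))
  · exact Or.inr ((strictAntiOn_rpow_sub_rpow ha hab hc₀ hc).injOn hsc hs₂.1.le
      (h.trans h₂.symm))

/-- for 0 < H₀ < H_max the equation s^{2k} − s^q = H₀ has exactly two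
positive solutions, one in (0, s*), the other in (s*, 1). -/
theorem two_solutions (n k : ℕ) (hk : 2 ≤ 2 * k) (hkn : 2 * k < n)
    (H₀ : ℝ) (hH₀ : 0 < H₀) (hH₁ : H₀ < Hmax n k) :
    let sstar : ℝ := (((n : ℝ) - 2 * (k : ℝ)) / (n : ℝ)) ^
      (((n : ℝ) - 2 * (k : ℝ)) / (4 * (k : ℝ) ^ 2))
    ∃ s₁ s₂ : ℝ, s₁ ∈ Set.Ioo 0 sstar ∧ s₂ ∈ Set.Ioo sstar 1 ∧
      s₁ ^ (2 * (k : ℝ)) - s₁ ^ (qe n k) = H₀ ∧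
      s₂ ^ (2 * (k : ℝ)) - s₂ ^ (qe n k) = H₀ ∧
      ∀ s : ℝ, 0 < s → s ^ (2 * (k : ℝ)) - s ^ (qe n k) = H₀ → s = s₁ ∨ s = s₂ := by
  have hk₀ : (0 : ℝ) < k := by
    have : 0 < k := by omega
    exact_mod_cast this
  have hd : (0 : ℝ) < n - 2 * k := by
    have : ((2 * k : ℕ) : ℝ) < n := by exact_mod_cast hkn
    push_cast at this
    linarith
  have hn : (0 : ℝ) < n := by linarith
  intro sstar
  have hr₀ : 0 < ((n : ℝ) - 2 * k) / n := div_pos hd hn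
  have hr₁ : ((n : ℝ) - 2 * k) / n < 1 := by
    rw [div_lt_one hn]
    linarith
  have hc₀ : 0 < sstar := Real.rpow_pos_of_pos hr₀ _
  have hc₁ : sstar < 1 := Real.rpow_lt_one hr₀.le hr₁ (by positivity)
  have hdiff : qe n k - 2 * (k : ℝ) = 4 * (k : ℝ) ^ 2 / (n - 2 * k) := by
    unfold qe
    field_simp
    ring
  have hpow : sstar ^ (qe n k - 2 * (k : ℝ)) = ((n : ℝ) - 2 * k) / n := by
    rw [hdiff, ← Real.rpow_mul hr₀.le]
    convert Real.rpow_one _ using 2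
    field_simp
  have hab : 2 * (k : ℝ) < qe n k := by
    rw [← sub_pos, hdiff]
    positivity
  have hmax : sstar ^ (2 * (k : ℝ)) - sstar ^ qe n k = Hmax n k := by
    have hq : sstar ^ qe n k = sstar ^ (2 * (k : ℝ)) * (((n : ℝ) - 2 * k) / n) := by
      rw [← hpow, ← Real.rpow_add hc₀]
      ring_nf
    have h2k : sstar ^ (2 * (k : ℝ)) =
        (((n : ℝ) - 2 * k) / n) ^ ((n : ℝ) / (2 * k) - 1) := by
      rw [← Real.rpow_mul hr₀.le]
      congr 1
      field_simp
      ring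
    rw [hq, h2k, Real.rpow_sub_one hr₀.ne', Hmax]
    field_simp
    ring
  refine exists_two_solutions_rpow_sub_rpow (by positivity) hab hc₀ hc₁ ?_ hH₀ (hmax ▸ hH₁)
  rw [hpow, qe]
  field_simp
end
end

section
/- For every H₀ with 0 < H₀ < H_max there exists a unique smooth positive function v : ℝ → ℝ that satisfies the Delaunay ODE h_v(t)^{k−1}·(v(t) − α⁻²v″(t)) = (n/(n−2k))·v(t)^{q−1} on all of ℝ, together with the conditions v′(0) = 0, v″(0) > 0, and H_v(t) = H₀ for all t ∈ ℝ. -/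
noncomputable section

open Real Set

section

open scoped NNReal

/-- A second-order autonomous equation with bounded Lipschitz force is solvable on every
symmetric interval. -/
theorem exists_secondOrder_solution_Ioo {g : ℝ → ℝ} {K B : ℝ≥0} (hg : LipschitzWith K g)
    (hB : ∀ x, |g x| ≤ B) (a T : ℝ) (hT : 0 < T) :
    ∃ y : ℝ → ℝ × ℝ, y 0 = (a, 0) ∧
      ∀ t ∈ Ioo (-T) T, HasDerivAt y ((y t).2, g (y t).1) t := by
  obtain ⟨T', hT'⟩ : ∃ T' : ℝ≥0, (T' : ℝ) = T := ⟨⟨T, hT.le⟩, rfl⟩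
  let X : ℝ → ℝ × ℝ → ℝ × ℝ := fun _ y ↦ (T⁻¹ * y.2, T * g y.1)
  have hX : ∀ t, LipschitzWith (max (T'⁻¹ * 1) (T' * (K * 1))) (X t) := fun t ↦
    LipschitzWith.prodMk
      ((lipschitzWith_smul (T⁻¹ : ℝ)).comp LipschitzWith.prod_snd |>.weaken (by
        simp [hT', ← NNReal.coe_le_coe, abs_of_pos hT]))
      ((lipschitzWith_smul (T : ℝ)).comp (hg.comp LipschitzWith.prod_fst) |>.weaken (by
        simp [hT', ← NNReal.coe_le_coe, abs_of_pos hT]))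
  have hPL : IsPicardLindelof X (tmin := -T) (tmax := T) ⟨0, by constructor <;> linarith⟩
      (a, (0 : ℝ)) (B * T' * T') 0 (B * T') (max (T'⁻¹ * 1) (T' * (K * 1))) := by
    refine ⟨fun t _ ↦ (hX t).lipschitzOnWith, fun x _ ↦ continuousOn_const, ?_, ?_⟩
    · intro t _ x hx
      have h2 : |x.2| ≤ B * T * T := by
        have := (norm_snd_le (x - (a, 0))).trans (mem_closedBall_iff_norm.1 hx)
        simpa [hT'] using this
      refine norm_prod_le_iff.2 ⟨?_, ?_⟩
      · simp only [X, norm_mul, norm_inv, Real.norm_eq_abs, abs_of_pos hT, NNReal.coe_mul, hT']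
        rw [inv_mul_le_iff₀ hT]
        linarith
      · simp only [X, norm_mul, Real.norm_eq_abs, abs_of_pos hT, NNReal.coe_mul, hT']
        linarith [mul_le_mul_of_nonneg_left (hB x.1) hT.le]
    · simp [hT']
  obtain ⟨y, hy0, hy⟩ := hPL.exists_eq_forall_mem_Icc_hasDerivWithinAt₀
  refine ⟨fun t ↦ ((y t).1, T⁻¹ * (y t).2), by simp [hy0], fun t ht ↦ ?_⟩
  have h := (hy t (Ioo_subset_Icc_self ht)).hasDerivAt (Icc_mem_nhds ht.1 ht.2)
  have h1 : HasDerivAt (fun t ↦ (y t).1) (T⁻¹ * (y t).2) t := h.fst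
  have h2 : HasDerivAt (fun t ↦ (y t).2) (T * g (y t).1) t := h.snd
  have h3 := h2.const_mul T⁻¹
  rw [inv_mul_cancel_left₀ hT.ne'] at h3
  exact h1.prodMk h3

theorem lipschitzWith_secondOrder_field {g : ℝ → ℝ} {K : ℝ≥0} (hg : LipschitzWith K g) :
    LipschitzWith (max 1 (K * 1)) fun y : ℝ × ℝ ↦ (y.2, g y.1) :=
  LipschitzWith.prod_snd.prodMk (hg.comp LipschitzWith.prod_fst)

/-- A second-order autonomous equation with bounded Lipschitz force has global solutions. -/
theorem exists_secondOrder_solution {g : ℝ → ℝ} {K B : ℝ≥0} (hg : LipschitzWith K g)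
    (hB : ∀ x, |g x| ≤ B) (a : ℝ) :
    ∃ y : ℝ → ℝ × ℝ, y 0 = (a, 0) ∧ ∀ t, HasDerivAt y ((y t).2, g (y t).1) t := by
  have hex : ∀ s : ℝ, ∃ y : ℝ → ℝ × ℝ, y 0 = (a, 0) ∧
      ∀ t ∈ Ioo (-(|s| + 1)) (|s| + 1), HasDerivAt y ((y t).2, g (y t).1) t := fun s ↦
    exists_secondOrder_solution_Ioo hg hB a _ (by positivity)
  choose Y hY0 hY using hex
  have key : ∀ s t, |t| ≤ |s| → Y t t = Y s t := by
    intro s t hts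
    have ht : t ∈ Ioo (-(|t| + 1)) (|t| + 1) := by rw [mem_Ioo, ← abs_lt]; linarith
    refine ODE_solution_unique_of_mem_Ioo (v := fun _ y ↦ (y.2, g y.1)) (s := fun _ ↦ univ)
      (t₀ := 0) (fun _ _ ↦ (lipschitzWith_secondOrder_field hg).lipschitzOnWith)
      (by constructor <;> linarith [abs_nonneg t])
      (fun r hr ↦ ⟨hY t r hr, trivial⟩)
      (fun r hr ↦ ⟨hY s r ⟨by linarith [hr.1], by linarith [hr.2]⟩, trivial⟩)
      ((hY0 t).trans (hY0 s).symm) ht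
  refine ⟨fun t ↦ Y t t, hY0 0, fun t ↦ ?_⟩
  have hs : |t| + 1 ≤ |(|t| + 1)| := le_abs_self _
  have ht : t ∈ Ioo (-(|t| + 1)) (|t| + 1) := by rw [mem_Ioo, ← abs_lt]; linarith
  have hd := hY (|t| + 1) t ⟨by linarith [ht.1], by linarith [ht.2]⟩
  have he : (fun t ↦ Y t t) =ᶠ[nhds t] Y (|t| + 1) := by
    filter_upwards [Ioo_mem_nhds ht.1 ht.2] with r hr
    exact key _ _ ((abs_lt.2 hr).le.trans hs)
  rw [← key (|t| + 1) t (by linarith)] at hd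
  exact hd.congr_of_eventuallyEq he

/-- A particle released at rest from the left end of a potential well oscillates inside it. -/
theorem exists_solution_of_potential {F f : ℝ → ℝ} {a b : ℝ} {K : ℝ≥0} (hab : a < b)
    (hF : ∀ x ∈ Icc a b, HasDerivAt F (f x) x) (hFa : F a = 0) (hFb : F b = 0)
    (hfa : 0 < f a) (hfb : f b < 0) (hf : LipschitzOnWith K f (Icc a b)) :
    ∃ v p : ℝ → ℝ, v 0 = a ∧ p 0 = 0 ∧ ∀ t, v t ∈ Icc a b ∧ HasDerivAt v (p t) t ∧
      HasDerivAt p (f (v t)) t ∧ p t ^ 2 = 2 * F (v t) := by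
  set g : ℝ → ℝ := fun x ↦ f (projIcc a b hab.le x) with hgdef
  have hg : LipschitzWith K g := by
    have := hf.to_restrict.comp (LipschitzWith.projIcc hab.le)
    rwa [mul_one] at this
  have hgf : ∀ x ∈ Icc a b, g x = f x := fun x hx ↦ by
    simp only [hgdef, projIcc_of_mem hab.le hx]
  have hga : ∀ x ≤ a, g x = f a := fun x hx ↦ by
    simp only [hgdef, projIcc_of_le_left hab.le hx]
  have hgb : ∀ x, b ≤ x → g x = f b := fun x hx ↦ by
    simp only [hgdef, projIcc_of_right_le hab.le hx]
  obtain ⟨B, hB⟩ : ∃ B : ℝ≥0, ∀ x, |g x| ≤ B := by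
    obtain ⟨C, hC⟩ := isCompact_Icc.exists_bound_of_continuousOn hf.continuousOn
    refine ⟨C.toNNReal, fun x ↦ (hC _ (projIcc a b hab.le x).2).trans (le_coe_toNNReal C)⟩
  obtain ⟨y, hy0, hy⟩ := exists_secondOrder_solution hg hB a
  have hv : ∀ t, HasDerivAt (fun t ↦ (y t).1) (y t).2 t := fun t ↦ (hy t).fst
  have hp : ∀ t, HasDerivAt (fun t ↦ (y t).2) (g (y t).1) t := fun t ↦ (hy t).snd
  have hcg : Continuous g := hg.continuous
  set P : ℝ → ℝ := fun x ↦ ∫ s in a..x, g s with hP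
  have hPd : ∀ x, HasDerivAt P (g x) x := fun x ↦
    (hcg.integral_hasStrictDerivAt a x).hasDerivAt
  have hPF : ∀ x ∈ Icc a b, P x = F x := by
    intro x hx
    have hsub : uIcc a x ⊆ Icc a b := by
      rw [uIcc_of_le hx.1]; exact Icc_subset_Icc_right hx.2
    have := intervalIntegral.integral_eq_sub_of_hasDerivAt (a := a) (b := x) (f := F) (f' := g)
      (fun z hz ↦ by rw [hgf z (hsub hz)]; exact hF z (hsub hz)) (hcg.intervalIntegrable _ _)
    rw [hP]
    simp only
    rw [this, hFa, sub_zero]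
  have henergy : ∀ t, (y t).2 ^ 2 = 2 * P (y t).1 := by
    have hE : ∀ t, HasDerivAt (fun t ↦ (y t).2 ^ 2 - 2 * P (y t).1) 0 t := fun t ↦ by
      have := ((hp t).pow 2).sub (((hPd _).comp t (hv t)).const_mul 2)
      convert! this using 1
      simp only [Nat.cast_ofNat]
      ring
    intro t
    have := is_const_of_deriv_eq_zero (fun t ↦ (hE t).differentiableAt)
      (fun t ↦ (hE t).deriv) t 0
    simp only [hy0, hP, intervalIntegral.integral_same] at this
    simp only [hP]
    linarith
  have hmem : ∀ t, (y t).1 ∈ Icc a b := by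
    intro t
    have h0 : 0 ≤ P (y t).1 := by nlinarith [henergy t, sq_nonneg (y t).2]
    by_contra hcon
    rw [mem_Icc, not_and_or, not_le, not_le] at hcon
    rcases hcon with h | h
    · have : P (y t).1 = ((y t).1 - a) * f a := by
        rw [hP]
        simp only
        rw [intervalIntegral.integral_congr (g := fun _ ↦ f a), intervalIntegral.integral_const,
          smul_eq_mul]
        intro x hx
        rw [uIcc_of_ge h.le] at hx
        exact hga x hx.2
      nlinarith
    · have : P (y t).1 = ((y t).1 - b) * f b := by
        have h1 : P (y t).1 = P b + ∫ s in b..(y t).1, g s := by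
          simp only [hP]
          rw [intervalIntegral.integral_add_adjacent_intervals] <;>
            exact hcg.intervalIntegrable _ _
        rw [h1, hPF b ⟨hab.le, le_rfl⟩, hFb, zero_add,
          intervalIntegral.integral_congr (g := fun _ ↦ f b), intervalIntegral.integral_const,
          smul_eq_mul]
        intro x hx
        rw [uIcc_of_le h.le] at hx
        exact hgb x hx.1
      nlinarith
  refine ⟨fun t ↦ (y t).1, fun t ↦ (y t).2, by simp [hy0], by simp [hy0], fun t ↦
    ⟨hmem t, hv t, ?_, ?_⟩⟩
  · rw [← hgf _ (hmem t)]; exact hp t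
  · simp only; rw [← hPF _ (hmem t)]; exact henergy t

theorem secondOrder_solution_unique {f v w p r : ℝ → ℝ} {s : Set ℝ} {K : ℝ≥0}
    (hf : LipschitzOnWith K f s)
    (hv : ∀ t, v t ∈ s ∧ HasDerivAt v (p t) t ∧ HasDerivAt p (f (v t)) t)
    (hw : ∀ t, w t ∈ s ∧ HasDerivAt w (r t) t ∧ HasDerivAt r (f (w t)) t)
    (h0 : v 0 = w 0) (h0' : p 0 = r 0) : v = w := by
  have hL : LipschitzOnWith (max 1 (K * 1)) (fun y : ℝ × ℝ ↦ (y.2, f y.1)) (s ×ˢ univ) :=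
    (LipschitzWith.prod_snd.lipschitzOnWith).prodMk
      (hf.comp LipschitzWith.prod_fst.lipschitzOnWith fun _ hx ↦ hx.1)
  have := ODE_solution_unique_univ (v := fun _ y ↦ (y.2, f y.1)) (s := fun _ ↦ s ×ˢ univ)
    (t₀ := 0) (f := fun t ↦ (v t, p t)) (g := fun t ↦ (w t, r t)) (fun _ ↦ hL)
    (fun t ↦ ⟨(hv t).2.1.prodMk (hv t).2.2, (hv t).1, trivial⟩)
    (fun t ↦ ⟨(hw t).2.1.prodMk (hw t).2.2, (hw t).1, trivial⟩) (by simp [h0, h0'])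
  exact funext fun t ↦ congrArg Prod.fst (congrFun this t)

theorem contDiff_of_secondOrder {f v p : ℝ → ℝ} {s : Set ℝ}
    (hf : ContDiffOn ℝ (⊤ : ℕ∞) f s) (hmem : ∀ t, v t ∈ s) (hv : ∀ t, HasDerivAt v (p t) t)
    (hp : ∀ t, HasDerivAt p (f (v t)) t) : ContDiff ℝ (⊤ : ℕ∞) v := by
  have key : ∀ m : ℕ, ContDiff ℝ m v ∧ ContDiff ℝ m p := by
    have hdv : deriv v = p := funext fun t ↦ (hv t).deriv
    have hdp : deriv p = fun t ↦ f (v t) := funext fun t ↦ (hp t).deriv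
    intro m
    induction m with
    | zero =>
      exact ⟨contDiff_zero.2 (continuous_iff_continuousAt.2 fun t ↦ (hv t).continuousAt),
        contDiff_zero.2 (continuous_iff_continuousAt.2 fun t ↦ (hp t).continuousAt)⟩
    | succ m ih =>
      push_cast
      rw [contDiff_succ_iff_deriv, contDiff_succ_iff_deriv, hdv, hdp]
      refine ⟨⟨fun t ↦ (hv t).differentiableAt, by simp, ih.2⟩,
        fun t ↦ (hp t).differentiableAt, by simp, ?_⟩
      exact (hf.of_le (by exact_mod_cast le_top)).comp_contDiff ih.1 hmem
  exact contDiff_infty.2 fun m ↦ (key m).1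

end

/-- The positive `k`-th root of `H + v ^ q`. -/
def energyRoot (k : ℕ) (q H v : ℝ) : ℝ := (H + v ^ q) ^ ((k : ℝ)⁻¹)

/-- The force of the second-order equation that the Delaunay equation becomes at energy `H`. -/
def delaunayForce (k : ℕ) (q H c v : ℝ) : ℝ :=
  c * (v - q / (2 * k) * v ^ (q - 1) / energyRoot k q H v ^ (k - 1))

section

variable {k : ℕ} {q H c x : ℝ}

theorem add_rpow_pos (hH : 0 < H) (hx : 0 < x) : 0 < H + x ^ q := by positivity

theorem energyRoot_pos (hH : 0 < H) (hx : 0 < x) : 0 < energyRoot k q H x :=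
  rpow_pos_of_pos (add_rpow_pos hH hx) _

theorem energyRoot_pow (hk : k ≠ 0) (hH : 0 < H) (hx : 0 < x) :
    energyRoot k q H x ^ k = H + x ^ q :=
  rpow_inv_natCast_pow (add_rpow_pos hH hx).le hk

theorem hasDerivAt_potential (hk : k ≠ 0) (hH : 0 < H) (hx : 0 < x) :
    HasDerivAt (fun x ↦ c / 2 * (x ^ 2 - energyRoot k q H x)) (delaunayForce k q H c x) x := by
  have h1 : HasDerivAt (fun x ↦ H + x ^ q) (q * x ^ (q - 1)) x :=
    (hasDerivAt_rpow_const (Or.inl hx.ne')).const_add H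
  have h2 := h1.rpow_const (p := (k : ℝ)⁻¹) (Or.inl (add_rpow_pos hH hx).ne')
  convert! ((hasDerivAt_pow 2 x).sub h2).const_mul (c / 2) using 1
  have hk' : (k : ℝ) ≠ 0 := by exact_mod_cast hk
  have hS := (energyRoot_pos (k := k) (q := q) hH hx).ne'
  have h3 : (H + x ^ q) ^ ((k : ℝ)⁻¹ - 1) = (energyRoot k q H x ^ (k - 1))⁻¹ := by
    have h4 : (H + x ^ q) ^ (k : ℝ)⁻¹ = energyRoot k q H x := rfl
    rw [rpow_sub_one (add_rpow_pos hH hx).ne', h4, ← energyRoot_pow hk hH hx,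
      ← pow_sub_one_mul hk]
    field_simp
  rw [h3, delaunayForce]
  field_simp
  ring

theorem contDiffOn_delaunayForce (hH : 0 < H) :
    ContDiffOn ℝ (⊤ : ℕ∞) (delaunayForce k q H c) (Ioi 0) := by
  have h : ∀ r : ℝ, ContDiffOn ℝ (⊤ : ℕ∞) (fun x : ℝ ↦ x ^ r) (Ioi 0) := fun r ↦
    contDiffOn_id.rpow_const_of_ne fun x hx ↦ (ne_of_gt hx)
  have hS : ContDiffOn ℝ (⊤ : ℕ∞) (energyRoot k q H) (Ioi 0) :=
    (contDiffOn_const.add (h q)).rpow_const_of_ne fun x hx ↦ (add_rpow_pos hH hx).ne'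
  exact contDiffOn_const.mul (contDiffOn_id.sub ((contDiffOn_const.mul (h _)).div (hS.pow _)
    fun x hx ↦ (pow_pos (energyRoot_pos hH hx) _).ne'))

theorem energyRoot_le_sq_iff (hk : k ≠ 0) (hH : 0 < H) (hx : 0 < x) :
    energyRoot k q H x ≤ x ^ 2 ↔ H ≤ x ^ (2 * k) - x ^ q := by
  rw [← pow_le_pow_iff_left₀ (energyRoot_pos hH hx).le (sq_nonneg x) hk, energyRoot_pow hk hH hx,
    ← pow_mul, le_sub_iff_add_le]

theorem energyRoot_eq_sq_iff (hk : k ≠ 0) (hH : 0 < H) (hx : 0 < x) :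
    energyRoot k q H x = x ^ 2 ↔ x ^ (2 * k) - x ^ q = H := by
  rw [← pow_left_inj₀ (energyRoot_pos hH hx).le (sq_nonneg x) hk, energyRoot_pow hk hH hx,
    ← pow_mul, eq_comm, sub_eq_iff_eq_add]

/-- At rest points of energy `H` the force simplifies. -/
theorem delaunayForce_of_rest (hk : k ≠ 0) (hH : 0 < H) (hx : 0 < x)
    (hw : x ^ (2 * k) - x ^ q = H) :
    delaunayForce k q H c x = c * x * (1 - q / (2 * k) * x ^ (q - 2 * k)) := by
  rw [delaunayForce, (energyRoot_eq_sq_iff hk hH hx).2 hw]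
  have h : x ^ (q - 1) = x ^ (q - 2 * k) * x * (x ^ 2) ^ (k - 1) := by
    rw [← pow_mul, ← rpow_natCast x (2 * (k - 1)), ← rpow_add_one hx.ne', ← rpow_add hx]
    congr 1
    push_cast [Nat.one_le_iff_ne_zero.2 hk]
    ring
  rw [h]
  field_simp

theorem hasDerivAt_pow_sub_rpow (hk : k ≠ 0) (hx : 0 < x) :
    HasDerivAt (fun x : ℝ ↦ x ^ (2 * k) - x ^ q)
      (x ^ (2 * k - 1) * (2 * k - q * x ^ (q - 2 * k))) x := by
  convert! (hasDerivAt_pow (2 * k) x).sub (hasDerivAt_rpow_const (p := q) (Or.inl hx.ne')) using 1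
  have h : x ^ (q - 1) = x ^ (q - 2 * k) * x ^ (2 * k - 1) := by
    rw [← rpow_natCast, ← rpow_add hx]
    congr 1
    push_cast [show 1 ≤ 2 * k by lia]
    ring
  rw [h]
  push_cast
  ring

theorem continuous_pow_sub_rpow (hq : 0 < q) : Continuous fun x : ℝ ↦ x ^ (2 * k) - x ^ q :=
  (continuous_pow _).sub (continuous_id.rpow_const fun _ ↦ Or.inr hq.le)

/-- The two rest points of energy `H` bound the region of energy at least `H`, and the left one
is characterised by the sign of the force. -/
theorem exists_rest_points (hk : k ≠ 0) (hq : 2 * (k : ℝ) < q) (hH : 0 < H)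
    (hHm : H < (1 - 2 * k / q) * (2 * k / q) ^ (2 * k / (q - 2 * k))) :
    ∃ a b : ℝ, 0 < a ∧ a < b ∧ a ^ (2 * k) - a ^ q = H ∧ b ^ (2 * k) - b ^ q = H ∧
      a ^ (q - 2 * k) < 2 * k / q ∧ 2 * k / q < b ^ (q - 2 * k) ∧
      (∀ x, 0 < x → H ≤ x ^ (2 * k) - x ^ q → x ∈ Icc a b) ∧
      ∀ x, 0 < x → x ^ (2 * k) - x ^ q = H → x ^ (q - 2 * k) < 2 * k / q → x = a := by
  have hk0 : (0 : ℝ) < k := by exact_mod_cast Nat.pos_of_ne_zero hk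
  have hq0 : 0 < q := by linarith
  have hd : 0 < q - 2 * k := by linarith
  have hr0 : 0 < 2 * k / q := by positivity
  have hr1 : 2 * k / q < 1 := (div_lt_one hq0).2 hq
  set w : ℝ → ℝ := fun x ↦ x ^ (2 * k) - x ^ q with hw
  have hwc : Continuous w := continuous_pow_sub_rpow hq0
  set m : ℝ := (2 * k / q) ^ (q - 2 * k)⁻¹ with hm
  have hm0 : 0 < m := rpow_pos_of_pos hr0 _
  have hm1 : m < 1 := rpow_lt_one hr0.le hr1 (inv_pos.2 hd)
  have hmd : m ^ (q - 2 * k) = 2 * k / q := rpow_inv_rpow hr0.le hd.ne'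
  have hlt : ∀ x, 0 < x → (x ^ (q - 2 * k) < 2 * k / q ↔ x < m) := fun x hx ↦ by
    rw [← hmd, rpow_lt_rpow_iff hx.le hm0.le hd]
  have hgt : ∀ x, 0 < x → (2 * k / q < x ^ (q - 2 * k) ↔ m < x) := fun x hx ↦ by
    rw [← hmd, rpow_lt_rpow_iff hm0.le hx.le hd]
  have hwm : H < w m := by
    have h1 : m ^ (2 * k) = (2 * k / q) ^ (2 * k / (q - 2 * k)) := by
      rw [hm, ← rpow_natCast, ← rpow_mul hr0.le]
      congr 1
      push_cast
      field_simp
    have h2 : m ^ q = m ^ (2 * k) * (2 * k / q) := by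
      rw [← hmd, ← rpow_natCast m (2 * k), ← rpow_add hm0]
      congr 1
      push_cast
      ring
    simp only [hw]
    rw [h2, h1]
    linarith
  have hmono : StrictMonoOn w (Icc 0 m) := by
    refine strictMonoOn_of_deriv_pos (convex_Icc _ _) hwc.continuousOn fun x hx ↦ ?_
    rw [interior_Icc] at hx
    rw [(hasDerivAt_pow_sub_rpow hk hx.1).deriv]
    have := (lt_div_iff₀ hq0).1 ((hlt x hx.1).2 hx.2)
    exact mul_pos (pow_pos hx.1 _) (by linarith)
  have hanti : StrictAntiOn w (Ici m) := by
    refine strictAntiOn_of_deriv_neg (convex_Ici _) hwc.continuousOn fun x hx ↦ ?_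
    rw [interior_Ici] at hx
    have hx0 : 0 < x := hm0.trans hx
    rw [(hasDerivAt_pow_sub_rpow hk hx0).deriv]
    have := (div_lt_iff₀ hq0).1 ((hgt x hx0).2 hx)
    exact mul_neg_of_pos_of_neg (pow_pos hx0 _) (by linarith)
  have hw0 : w 0 = 0 := by simp [hw, hk, hq0.ne']
  have hw1 : w 1 = 0 := by simp [hw]
  obtain ⟨a, ha, haH⟩ := intermediate_value_Ioo hm0.le hwc.continuousOn
    (show H ∈ Ioo (w 0) (w m) from ⟨by rwa [hw0], hwm⟩)
  obtain ⟨b, hb, hbH⟩ := intermediate_value_Ioo' hm1.le hwc.continuousOn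
    (show H ∈ Ioo (w 1) (w m) from ⟨by rwa [hw1], hwm⟩)
  refine ⟨a, b, ha.1, ha.2.trans hb.1, haH, hbH, (hlt a ha.1).2 ha.2,
    (hgt b (hm0.trans hb.1)).2 hb.1, fun x hx hHx ↦ ⟨?_, ?_⟩, fun x hx hxH hxm ↦ ?_⟩
  · by_contra! hxa
    have := hmono ⟨hx.le, (hxa.trans ha.2).le⟩ ⟨ha.1.le, ha.2.le⟩ hxa
    rw [haH] at this
    exact this.not_ge hHx
  · by_contra! hbx
    have := hanti hb.1.le (hb.1.trans hbx).le hbx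
    rw [hbH] at this
    exact this.not_ge hHx
  · exact hmono.injOn ⟨hx.le, ((hlt x hx).1 hxm).le⟩ ⟨ha.1.le, ha.2.le⟩ (hxH.trans haH.symm)

end

section

variable {n k : ℕ}

theorem alp_pos (hk : k ≠ 0) (hkn : 2 * k < n) : 0 < alp n k := by
  have hk0 : (0 : ℝ) < k := by exact_mod_cast Nat.pos_of_ne_zero hk
  have hd : (0 : ℝ) < n - 2 * k := by
    rw [sub_pos]; exact_mod_cast hkn
  exact div_pos hd (by linarith)

theorem qe_div_two_mul (hk : k ≠ 0) : qe n k / (2 * k) = n / (n - 2 * k) := by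
  have hk0 : (k : ℝ) ≠ 0 := by exact_mod_cast hk
  rw [qe]
  field_simp

theorem two_mul_lt_qe (hk : k ≠ 0) (hkn : 2 * k < n) : 2 * (k : ℝ) < qe n k := by
  have hk0 : (0 : ℝ) < k := by exact_mod_cast Nat.pos_of_ne_zero hk
  have hd : (0 : ℝ) < n - 2 * k := by
    rw [sub_pos]; exact_mod_cast hkn
  rw [qe, lt_div_iff₀ hd]
  nlinarith

theorem Hmax_eq (hk : k ≠ 0) (hkn : 2 * k < n) :
    Hmax n k = (1 - 2 * k / qe n k) * (2 * k / qe n k) ^ (2 * k / (qe n k - 2 * k)) := by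
  have hk0 : (0 : ℝ) < k := by exact_mod_cast Nat.pos_of_ne_zero hk
  have hd : (0 : ℝ) < n - 2 * k := by
    rw [sub_pos]; exact_mod_cast hkn
  have hn : (0 : ℝ) < n := by linarith
  have h1 : 2 * k / qe n k = (n - 2 * k) / n := by
    rw [qe]; field_simp
  have h2 : 2 * k / (qe n k - 2 * k) = (n : ℝ) / (2 * k) - 1 := by
    have : qe n k - 2 * k = 2 * k * (2 * k) / (n - 2 * k) := by
      rw [qe]; field_simp; ring
    rw [this]; field_simp
  rw [h1, h2, rpow_sub_one (div_pos hd hn).ne', Hmax]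
  field_simp
  ring

variable {H : ℝ} {v : ℝ → ℝ}

/-- The quantity `h_v` of a solution of positive energy is the positive `k`-th root. -/
theorem hDel_eq_energyRoot (hk : k ≠ 0) (hH : 0 < H) (hv : DelSol n k H v) (t : ℝ) :
    hDel n k v t = energyRoot k (qe n k) H (v t) := by
  obtain ⟨hsm, hpos, -, hd0, -, hE⟩ := hv
  have hpow : ∀ t, hDel n k v t ^ k = H + v t ^ qe n k := fun t ↦ by
    have := hE t
    rw [HDel] at this
    linarith
  have hcont : Continuous (hDel n k v) :=
    (hsm.continuous.pow 2).sub
      (continuous_const.mul ((hsm.continuous_deriv (by simp)).pow 2))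
  have hne : ∀ t, hDel n k v t ≠ 0 := fun t h ↦ by
    have := hpow t
    rw [h, zero_pow hk] at this
    linarith [add_rpow_pos (q := qe n k) hH (hpos t)]
  have h0 : 0 < hDel n k v 0 := by
    rw [hDel, hd0]
    simpa using pow_pos (hpos 0) 2
  have hp : 0 < hDel n k v t := by
    by_contra! hle
    obtain ⟨s, hs⟩ := mem_range_of_exists_le_of_exists_ge hcont ⟨t, hle⟩ ⟨0, h0.le⟩
    exact hne s hs
  rw [energyRoot, ← hpow, pow_rpow_inv_natCast hp.le hk]

theorem DelSol.deriv_sq (hk : k ≠ 0) (hH : 0 < H) (hv : DelSol n k H v)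
    (t : ℝ) : ((alp n k)⁻¹ * deriv v t) ^ 2 = v t ^ 2 - energyRoot k (qe n k) H (v t) := by
  rw [← hDel_eq_energyRoot hk hH hv, hDel]
  ring

theorem DelSol.hasDerivAt (hv : DelSol n k H v) (t : ℝ) : HasDerivAt v (deriv v t) t :=
  (hv.1.differentiable (by simp) t).hasDerivAt

theorem DelSol.hasDerivAt_deriv (hk : k ≠ 0) (hkn : 2 * k < n) (hH : 0 < H)
    (hv : DelSol n k H v) (t : ℝ) :
    HasDerivAt (deriv v) (delaunayForce k (qe n k) H (alp n k ^ 2) (v t)) t := by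
  have hd : DifferentiableAt ℝ (deriv v) t :=
    ((contDiff_infty_iff_deriv.1 hv.1).2.differentiable (by simp)) t
  have hode := hv.2.2.1 t
  rw [hDel_eq_energyRoot hk hH hv, ← qe_div_two_mul hk] at hode
  have hS := (energyRoot_pos (k := k) (q := qe n k) hH (hv.2.1 t)).ne'
  have hα := (alp_pos hk hkn).ne'
  convert! hd.hasDerivAt using 1
  rw [delaunayForce, ← hode, mul_div_cancel_left₀ _ (pow_ne_zero _ hS)]
  field_simp
  ring

theorem DelSol.le_pow_sub_rpow (hk : k ≠ 0) (hH : 0 < H)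
    (hv : DelSol n k H v) (t : ℝ) : H ≤ v t ^ (2 * k) - v t ^ qe n k := by
  rw [← energyRoot_le_sq_iff hk hH (hv.2.1 t)]
  linarith [hv.deriv_sq hk hH t, sq_nonneg ((alp n k)⁻¹ * deriv v t)]

theorem DelSol.zero_rest (hk : k ≠ 0) (hH : 0 < H) (hv : DelSol n k H v) :
    v 0 ^ (2 * k) - v 0 ^ qe n k = H := by
  rw [← energyRoot_eq_sq_iff hk hH (hv.2.1 0)]
  have := hv.deriv_sq hk hH 0
  rw [hv.2.2.2.1] at this
  linarith

theorem DelSol.zero_rpow_lt (hk : k ≠ 0) (hkn : 2 * k < n) (hH : 0 < H)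
    (hv : DelSol n k H v) : v 0 ^ (qe n k - 2 * k) < 2 * k / qe n k := by
  have hk0 : (0 : ℝ) < k := by exact_mod_cast Nat.pos_of_ne_zero hk
  have hq0 : 0 < qe n k := by linarith [two_mul_lt_qe hk hkn]
  have h := hv.2.2.2.2.1
  rw [(hv.hasDerivAt_deriv hk hkn hH 0).deriv,
    delaunayForce_of_rest hk hH (hv.2.1 0) (hv.zero_rest hk hH)] at h
  have hα := alp_pos hk hkn
  have := pos_of_mul_pos_right h (mul_pos (pow_pos hα 2) (hv.2.1 0)).le
  rw [lt_div_iff₀ hq0]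
  have h2 : qe n k / (2 * k) * v 0 ^ (qe n k - 2 * k) < 1 := by linarith
  rw [div_mul_eq_mul_div, div_lt_one (by linarith)] at h2
  linarith

/-- An energy-`H` solution of the reduced second-order equation is a Delaunay solution. -/
theorem delSol_of_secondOrder (hk : k ≠ 0) (hkn : 2 * k < n) (hH : 0 < H) {p : ℝ → ℝ}
    (hpos : ∀ t, 0 < v t) (hv : ∀ t, HasDerivAt v (p t) t)
    (hp : ∀ t, HasDerivAt p (delaunayForce k (qe n k) H (alp n k ^ 2) (v t)) t)
    (hE : ∀ t, p t ^ 2 = alp n k ^ 2 * (v t ^ 2 - energyRoot k (qe n k) H (v t)))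
    (hp0 : p 0 = 0) (hf0 : 0 < delaunayForce k (qe n k) H (alp n k ^ 2) (v 0)) :
    DelSol n k H v := by
  have hα := (alp_pos hk hkn).ne'
  have hdv : deriv v = p := funext fun t ↦ (hv t).deriv
  have hh : ∀ t, hDel n k v t = energyRoot k (qe n k) H (v t) := fun t ↦ by
    rw [hDel, hdv, hE]
    field_simp
    ring
  refine ⟨contDiff_of_secondOrder (contDiffOn_delaunayForce hH) hpos hv hp, hpos, fun t ↦ ?_,
    by rw [hdv, hp0], by rwa [hdv, (hp 0).deriv], fun t ↦ ?_⟩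
  · have hS := (energyRoot_pos (k := k) (q := qe n k) hH (hpos t)).ne'
    rw [hh, hdv, (hp t).deriv, delaunayForce, ← qe_div_two_mul hk]
    field_simp
    ring
  · rw [HDel, hh, energyRoot_pow hk hH (hpos t)]
    ring

end

/-- existence and uniqueness of the Delaunay solution with parameter H₀. -/
theorem delaunay_exists_unique (n k : ℕ) (hk : 2 ≤ 2 * k) (hkn : 2 * k < n)
    (H₀ : ℝ) (hH₀ : 0 < H₀) (hH₁ : H₀ < Hmax n k) :
    ∃! v : ℝ → ℝ, ContDiff ℝ (⊤ : ℕ∞) v ∧ (∀ t, 0 < v t) ∧ DelODE n k v ∧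
      deriv v 0 = 0 ∧ 0 < deriv (deriv v) 0 ∧ ∀ t, HDel n k v t = H₀ := by
  change ∃! v : ℝ → ℝ, DelSol n k H₀ v
  have hk0 : k ≠ 0 := by lia
  have hα := alp_pos hk0 hkn
  have hq := two_mul_lt_qe hk0 hkn
  have hkpos : (0 : ℝ) < k := by exact_mod_cast Nat.pos_of_ne_zero hk0
  have hq0 : 0 < qe n k := by linarith
  rw [Hmax_eq hk0 hkn] at hH₁
  obtain ⟨a, b, ha, hab, haH, hbH, haq, hbq, hmem, huniq⟩ := exists_rest_points hk0 hq hH₀ hH₁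
  have hpos : ∀ x ∈ Icc a b, 0 < x := fun x hx ↦ ha.trans_le hx.1
  have hcd : ContDiffOn ℝ 1 (delaunayForce k (qe n k) H₀ (alp n k ^ 2)) (Icc a b) :=
    ((contDiffOn_delaunayForce hH₀).mono hpos).of_le (by exact_mod_cast le_top)
  obtain ⟨K, hK⟩ := hcd.exists_lipschitzOnWith one_ne_zero (convex_Icc a b) isCompact_Icc
  refine existsUnique_of_exists_of_unique ?_ fun v w hv hw ↦ ?_
  · have hforce : ∀ x, 0 < x → x ^ (2 * k) - x ^ qe n k = H₀ →
        delaunayForce k (qe n k) H₀ (alp n k ^ 2) x = alp n k ^ 2 * x * (qe n k / (2 * k)) *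
          (2 * k / qe n k - x ^ (qe n k - 2 * k)) := fun x hx hxH ↦ by
      rw [delaunayForce_of_rest hk0 hH₀ hx hxH]
      field_simp
    have hfa : 0 < delaunayForce k (qe n k) H₀ (alp n k ^ 2) a := by
      rw [hforce a ha haH]
      exact mul_pos (by positivity) (by linarith)
    have hb := ha.trans hab
    have hfb : delaunayForce k (qe n k) H₀ (alp n k ^ 2) b < 0 := by
      rw [hforce b hb hbH]
      exact mul_neg_of_pos_of_neg (by positivity) (by linarith)
    obtain ⟨v, p, hv0, hp0, hvp⟩ := exists_solution_of_potential hab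
      (fun x hx ↦ hasDerivAt_potential (c := alp n k ^ 2) hk0 hH₀ (hpos x hx))
      (by rw [(energyRoot_eq_sq_iff hk0 hH₀ ha).2 haH]; ring)
      (by rw [(energyRoot_eq_sq_iff hk0 hH₀ hb).2 hbH]; ring) hfa hfb hK
    exact ⟨v, delSol_of_secondOrder hk0 hkn hH₀ (fun t ↦ hpos _ (hvp t).1)
      (fun t ↦ (hvp t).2.1) (fun t ↦ (hvp t).2.2.1)
      (fun t ↦ by rw [(hvp t).2.2.2]; ring) hp0 (by rwa [hv0])⟩
  · have key : ∀ u, DelSol n k H₀ u → u 0 = a ∧ ∀ t, u t ∈ Icc a b ∧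
        HasDerivAt u (deriv u t) t ∧
        HasDerivAt (deriv u) (delaunayForce k (qe n k) H₀ (alp n k ^ 2) (u t)) t := fun u hu ↦
      ⟨huniq _ (hu.2.1 0) (hu.zero_rest hk0 hH₀) (hu.zero_rpow_lt hk0 hkn hH₀),
        fun t ↦ ⟨hmem _ (hu.2.1 t) (hu.le_pow_sub_rpow hk0 hH₀ t), hu.hasDerivAt t,
          hu.hasDerivAt_deriv hk0 hkn hH₀ t⟩⟩
    exact secondOrder_solution_unique hK (key v hv).2 (key w hw).2
      ((key v hv).1.trans (key w hw).1.symm) (hv.2.2.2.1.trans hw.2.2.2.1.symm)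
end
end

section
/- There exists a constant c > 0 depending only on n and k such that for every H₀ ∈ (0, H_max), every Delaunay solution v with parameter H₀, every t ∈ ℝ, and every real number λ ≥ 2n (in particular for every eigenvalue λ_j of the Laplacian on S^{n−1} with j ≥ n+1), one has a(t)·λ + p(t) ≥ c, where a and p are the coefficients of the conjugate linearized operator associated with v. -/
noncomputable section

open Real Set

/-- Along a Delaunay solution the quantity `h_v` stays positive: it is continuous, never vanishes,
and equals `v(0)²` at time `0`. -/
theorem DelSol.hDel_pos {n k : ℕ} {H₀ : ℝ} {v : ℝ → ℝ} (hk : k ≠ 0) (hH : 0 < H₀)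
    (hv : DelSol n k H₀ v) (t : ℝ) : 0 < hDel n k v t := by
  obtain ⟨hsmooth, hpos, -, hv0, -, hcons⟩ := hv
  have hcont : Continuous (hDel n k v) := by
    have h1 : Continuous (deriv v) := hsmooth.continuous_deriv (by simp)
    have h0 : Continuous v := hsmooth.continuous
    unfold hDel
    fun_prop
  have hne : ∀ s, hDel n k v s ≠ 0 := by
    intro s hs
    have h1 := hcons s
    have h2 := Real.rpow_pos_of_pos (hpos s) (qe n k)
    rw [HDel, hs, zero_pow hk] at h1
    linarith
  have h0 : 0 < hDel n k v 0 := by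
    have := hpos 0
    simp only [hDel, hv0]
    simpa using pow_pos this 2
  by_contra! hneg
  obtain ⟨s, hs⟩ := mem_range_of_exists_le_of_exists_ge hcont ⟨t, hneg⟩ ⟨0, h0.le⟩
  exact hne s hs

theorem hDel_le_sq (n k : ℕ) (v : ℝ → ℝ) (t : ℝ) : hDel n k v t ≤ v t ^ 2 := by
  have : 0 ≤ ((alp n k)⁻¹) ^ 2 * (deriv v t) ^ 2 := by positivity
  unfold hDel
  linarith

/-- `v^q = (v² · v^{4k/(n-2k)})^k`. -/
theorem rpow_qe {n k : ℕ} (hkn : 2 * k < n) {x : ℝ} (hx : 0 < x) :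
    x ^ qe n k = (x ^ 2 * x ^ (4 * (k : ℝ) / ((n : ℝ) - 2 * (k : ℝ)))) ^ k := by
  have hd : (n : ℝ) - 2 * (k : ℝ) ≠ 0 := by
    have : (2 * k : ℝ) < n := by exact_mod_cast hkn
    linarith
  rw [← Real.rpow_natCast x 2, ← Real.rpow_add hx, ← Real.rpow_natCast, ← Real.rpow_mul hx.le, qe]
  congr 1
  push_cast
  field_simp
  ring

/-- The two mixed terms of the potential, expressed through `F` and the ratio `h / v²`. -/
theorem DelSol.mixed_terms {n k : ℕ} {H₀ : ℝ} {v : ℝ → ℝ} (hk : k ≠ 0) (hkn : 2 * k < n)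
    (hH : 0 < H₀) (hv : DelSol n k H₀ v) (t : ℝ) :
    (v t) ^ (4 * (k : ℝ) / ((n : ℝ) - 2 * (k : ℝ))) *
        (FDel n k H₀ v t) ^ (((k : ℝ) - 1) / (k : ℝ)) =
      FDel n k H₀ v t * (hDel n k v t / v t ^ 2) ∧
    (v t) ^ (4 * (k : ℝ) / ((n : ℝ) - 2 * (k : ℝ))) *
        (FDel n k H₀ v t) ^ ((2 * (k : ℝ) - 1) / (k : ℝ)) =
      FDel n k H₀ v t ^ 2 * (hDel n k v t / v t ^ 2) := by
  have hh := hv.hDel_pos hk hH t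
  have hvt : 0 < v t := hv.2.1 t
  have hcons : hDel n k v t ^ k = H₀ + v t ^ qe n k := by
    have := hv.2.2.2.2.2 t
    rw [HDel] at this
    linarith
  have hF : FDel n k H₀ v t =
      (v t ^ 2 * v t ^ (4 * (k : ℝ) / ((n : ℝ) - 2 * (k : ℝ))) / hDel n k v t) ^ k := by
    rw [FDel, ← hcons, rpow_qe hkn hvt, div_pow]
  have hw := Real.rpow_pos_of_pos hvt (4 * (k : ℝ) / ((n : ℝ) - 2 * (k : ℝ)))
  set w := v t ^ (4 * (k : ℝ) / ((n : ℝ) - 2 * (k : ℝ)))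
  set F := FDel n k H₀ v t
  have hY : 0 < v t ^ 2 * w / hDel n k v t := by positivity
  have hFpos : 0 < F := hF ▸ pow_pos hY k
  have hk' : (k : ℝ) ≠ 0 := Nat.cast_ne_zero.mpr hk
  have hroot : F ^ (-(k : ℝ)⁻¹) = (v t ^ 2 * w / hDel n k v t)⁻¹ := by
    rw [Real.rpow_neg hFpos.le, hF, Real.pow_rpow_inv_natCast hY.le hk]
  have e1 : ((k : ℝ) - 1) / k = 1 + -(k : ℝ)⁻¹ := by field_simp; ring
  have e2 : (2 * (k : ℝ) - 1) / k = (2 : ℕ) + -(k : ℝ)⁻¹ := by push_cast; field_simp; ring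
  rw [e1, e2, Real.rpow_add hFpos, Real.rpow_add hFpos, Real.rpow_one, Real.rpow_natCast, hroot]
  constructor <;> field_simp

/-- Lower bound for `a(t) · 2n + p(t)` as a function of `F ∈ [0, 1]` and `X = h / v² ≤ 1`: the
expression decreases in `X`, and at `X = 1` it is a concave quadratic in `F` taking values at least
`α²` and `1` at the endpoints. -/
theorem coercivity_quadratic_bound {N K F X c : ℝ} (hK : 1 ≤ K) (hN : 2 * K < N) (hF₀ : 0 ≤ F)
    (hF₁ : F ≤ 1) (hX : X ≤ 1) (hc : c ≤ ((N - 2 * K) / (2 * K)) ^ 2) (hc₁ : c ≤ 1) :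
    c ≤ ((N - K) / (K * (N - 1)) + N * (K - 1) / (K * (N - 1)) * F) * (2 * N) +
      (((N - 2 * K) / (2 * K)) ^ 2 + N * (N * K + N - 2 * K) * (K - 1) / (2 * K ^ 2) * F
        - N ^ 2 * (K ^ 2 - 1) / (4 * K ^ 2) * F ^ 2
        - N * (2 * K * N - N + 2 * K) / (4 * K) * (F * X)
        + N ^ 2 * K * (K - 1) / (4 * K ^ 2) * (F ^ 2 * X)) := by
  have hK0 : 0 < K := by linarith
  have hN1 : 0 < N - 1 := by linarith
  have hN0 : 0 < N := by linarith
  have h0 : 0 ≤ 2 * N * (N - K) / (K * (N - 1)) :=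
    div_nonneg (mul_nonneg (by linarith) (by linarith)) (by positivity)
  have hE : 0 ≤ N ^ 2 * (K - 1) / (4 * K ^ 2) :=
    div_nonneg (mul_nonneg (by positivity) (by linarith)) (by positivity)
  have hD : 0 ≤ N ^ 2 * (K - 1) / (4 * K) :=
    div_nonneg (mul_nonneg (by positivity) (by linarith)) (by positivity)
  have key : ((N - K) / (K * (N - 1)) + N * (K - 1) / (K * (N - 1)) * F) * (2 * N) +
      (((N - 2 * K) / (2 * K)) ^ 2 + N * (N * K + N - 2 * K) * (K - 1) / (2 * K ^ 2) * F
        - N ^ 2 * (K ^ 2 - 1) / (4 * K ^ 2) * F ^ 2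
        - N * (2 * K * N - N + 2 * K) / (4 * K) * (F * X)
        + N ^ 2 * K * (K - 1) / (4 * K ^ 2) * (F ^ 2 * X)) =
      (1 - F) * (((N - 2 * K) / (2 * K)) ^ 2 + 2 * N * (N - K) / (K * (N - 1)))
        + F * (1 + N / 2) + N ^ 2 * (K - 1) / (4 * K ^ 2) * (F * (1 - F))
        + (1 - X) * F * (N * (N + 2) / 4 + N ^ 2 * (K - 1) / (4 * K) * (1 - F)) := by
    field_simp
    ring
  rw [key]
  have hF' : 0 ≤ 1 - F := by linarith
  have hX' : 0 ≤ 1 - X := by linarith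
  have t1 : (1 - F) * c ≤
      (1 - F) * (((N - 2 * K) / (2 * K)) ^ 2 + 2 * N * (N - K) / (K * (N - 1))) :=
    mul_le_mul_of_nonneg_left (by linarith) hF'
  have t2 : F * c ≤ F * (1 + N / 2) := mul_le_mul_of_nonneg_left (by linarith) hF₀
  have t3 : 0 ≤ N ^ 2 * (K - 1) / (4 * K ^ 2) * (F * (1 - F)) := by positivity
  have t4 : 0 ≤ (1 - X) * F * (N * (N + 2) / 4 + N ^ 2 * (K - 1) / (4 * K) * (1 - F)) := by
    positivity
  linarith

/-- uniform coercivity of the conjugate linearized operator along the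
high frequencies (eigenvalues λ ≥ 2n). -/
theorem high_frequency_coercivity (n k : ℕ) (hk : 2 ≤ 2 * k) (hkn : 2 * k < n) :
    ∃ c > (0 : ℝ), ∀ H₀ : ℝ, 0 < H₀ → H₀ < Hmax n k →
      ∀ v : ℝ → ℝ, DelSol n k H₀ v →
      ∀ t : ℝ, ∀ lam : ℝ, 2 * (n : ℝ) ≤ lam →
        c ≤ aDel n k H₀ v t * lam + pDel n k H₀ v t := by
  have hkpos : 1 ≤ k := by omega
  have hK : (1 : ℝ) ≤ k := by exact_mod_cast hkpos
  have hN : 2 * (k : ℝ) < n := by exact_mod_cast hkn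
  have halp : 0 < alp n k := div_pos (by linarith) (by linarith)
  refine ⟨min (alp n k ^ 2) 1, lt_min (by positivity) one_pos, ?_⟩
  intro H₀ hH _ v hv t lam hlam
  have hvt : 0 < v t := hv.2.1 t
  have hk0 : k ≠ 0 := by omega
  have hvq := Real.rpow_pos_of_pos hvt (qe n k)
  have hF₀ : 0 ≤ FDel n k H₀ v t := by unfold FDel; positivity
  have hF₁ : FDel n k H₀ v t ≤ 1 := div_le_one_of_le₀ (by linarith) (by linarith)
  have hX : hDel n k v t / v t ^ 2 ≤ 1 :=
    div_le_one_of_le₀ (hDel_le_sq n k v t) (by positivity)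
  have ha : 0 ≤ aDel n k H₀ v t :=
    add_nonneg (div_nonneg (by linarith) (mul_nonneg (by linarith) (by linarith)))
      (mul_nonneg (div_nonneg (mul_nonneg (by linarith) (by linarith))
        (mul_nonneg (by linarith) (by linarith))) hF₀)
  obtain ⟨e1, e2⟩ := hv.mixed_terms hk0 hkn hH t
  calc min (alp n k ^ 2) 1 ≤ aDel n k H₀ v t * (2 * n) + pDel n k H₀ v t := by
        rw [aDel, pDel, mul_assoc _ (v t ^ _), mul_assoc _ (v t ^ _), e1, e2]
        exact coercivity_quadratic_bound hK hN hF₀ hF₁ hX (min_le_left _ _) (min_le_right _ _)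
    _ ≤ aDel n k H₀ v t * lam + pDel n k H₀ v t := by gcongr
end
end

section
/- Let v be a Delaunay solution with parameter H₀ ∈ (0, H_max) and let T > 0 be a period of v (v(t + T) = v(t) for all t). Then there exist m₀ ∈ ℕ and r₀ > 0 such that for every integer m̃ ≥ m₀ and every r̃ with |r̃| ≤ r₀, the number R := m̃·T + r̃ satisfies both α + (v′(R)/v(R))·tanh(R) ≠ 0 and α·tanh(R) + v′(R)/v(R) ≠ 0. -/
noncomputable section

open Real Set

lemma half_lt_tanh_of_one_le {x : ℝ} (hx : 1 ≤ x) : 1 / 2 < Real.tanh x := by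
  rw [Real.tanh_eq_sinh_div_cosh, lt_div_iff₀ (Real.cosh_pos x), Real.sinh_eq, Real.cosh_eq]
  have hsum : 2 * x + 1 < Real.exp (2 * x) := Real.add_one_lt_exp (by linarith)
  have hmul : Real.exp (2 * x) * Real.exp (-x) = Real.exp x := by
    rw [← Real.exp_add]
    ring_nf
  nlinarith [Real.exp_pos (-x)]

lemma periodic_deriv {f : ℝ → ℝ} {c : ℝ} (hf : Function.Periodic f c) :
    Function.Periodic (deriv f) c := by
  intro x
  rw [← deriv_comp_add_const f c x, funext hf]

lemma exists_abs_logDeriv_lt {v : ℝ → ℝ} (hv : ContDiff ℝ 1 v) (hpos : ∀ t, 0 < v t)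
    (hzero : deriv v 0 = 0) {ε : ℝ} (hε : 0 < ε) :
    ∃ r : ℝ, 0 < r ∧ ∀ t, |t| < r → |deriv v t / v t| < ε := by
  have hcont : Continuous fun t => deriv v t / v t :=
    (hv.continuous_deriv le_rfl).div hv.continuous fun t => (hpos t).ne'
  obtain ⟨r, hr, h⟩ := Metric.continuous_iff.mp hcont 0 ε hε
  refine ⟨r, hr, fun t ht => ?_⟩
  simpa [Real.dist_eq, hzero, abs_div] using h t (by simpa [Real.dist_eq] using ht)

/-- nondegeneracy of the boundary conditions at radii R = mt·T + rt. -/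
theorem nondegenerate_radii (n k : ℕ) (hk : 2 ≤ 2 * k) (hkn : 2 * k < n)
    (H₀ : ℝ) (hH₀ : 0 < H₀) (hH₁ : H₀ < Hmax n k)
    (v : ℝ → ℝ) (hsol : DelSol n k H₀ v)
    (T : ℝ) (hT : 0 < T) (hper : ∀ t, v (t + T) = v t) :
    ∃ (m₀ : ℕ) (r₀ : ℝ), 0 < r₀ ∧
      ∀ mt : ℕ, m₀ ≤ mt → ∀ rt : ℝ, |rt| ≤ r₀ →
        (alp n k + (deriv v ((mt : ℝ) * T + rt) / v ((mt : ℝ) * T + rt)) *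
            Real.tanh ((mt : ℝ) * T + rt) ≠ 0) ∧
        (alp n k * Real.tanh ((mt : ℝ) * T + rt) +
            deriv v ((mt : ℝ) * T + rt) / v ((mt : ℝ) * T + rt) ≠ 0) := by
  obtain ⟨hv, hpos, -, hzero, -, -⟩ := hsol
  have hα : 0 < alp n k := by
    have hk' : (0 : ℝ) < k := by exact_mod_cast (by omega : 0 < k)
    have hkn' : 2 * (k : ℝ) < n := by exact_mod_cast hkn
    exact div_pos (by linarith) (by linarith)
  obtain ⟨r, hr, hsmall⟩ :=
    exists_abs_logDeriv_lt (hv.of_le (by exact_mod_cast le_top)) hpos hzero (half_pos hα)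
  obtain ⟨m, hm⟩ := exists_nat_ge (2 / T)
  refine ⟨m, min 1 (r / 2), by positivity, fun mt hmt rt hrt => ?_⟩
  have hrt_one : |rt| ≤ 1 := hrt.trans (min_le_left _ _)
  have hrt_half : |rt| ≤ r / 2 := hrt.trans (min_le_right _ _)
  have hR : 1 ≤ (mt : ℝ) * T + rt := by
    have hmT : 2 ≤ (mt : ℝ) * T :=
      (div_le_iff₀ hT).mp (hm.trans (by exact_mod_cast hmt))
    linarith [(abs_le.mp hrt_one).1]
  have hshift : ∀ {f : ℝ → ℝ}, Function.Periodic f T → f ((mt : ℝ) * T + rt) = f rt :=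
    fun hf => by rw [add_comm, hf.nat_mul mt rt]
  rw [hshift hper, hshift (periodic_deriv hper)]
  have htanh := half_lt_tanh_of_one_le hR
  have htanh_lt := Real.tanh_lt_one ((mt : ℝ) * T + rt)
  obtain ⟨hlow, -⟩ := abs_lt.mp (hsmall rt (by linarith))
  exact ⟨ne_of_gt (by nlinarith), ne_of_gt (by nlinarith)⟩
end
end

section
/- Every Delaunay solution v with parameter H₀ ∈ (0, H_max) is an even function: v(−t) = v(t) for all t ∈ ℝ. -/
noncomputable section

open Real Set

/-- A positive solution of the autonomous equation `v'' = g v`, with `g` of class `C¹` on the positive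
half-line, is even as soon as `v' 0 = 0`. -/
theorem even_of_deriv_deriv_eq {g v : ℝ → ℝ} (hg : ContDiffOn ℝ 1 g (Ioi 0))
    (hv : ContDiff ℝ 2 v) (hpos : ∀ t, 0 < v t) (hode : ∀ t, deriv (deriv v) t = g (v t))
    (h0 : deriv v 0 = 0) (t : ℝ) : v (-t) = v t := by
  obtain ⟨T, hT0, htT⟩ : ∃ T : ℝ, 0 < T ∧ t ∈ Ioo (-T) T :=
    ⟨|t| + 1, by positivity, abs_lt.mp (lt_add_one _)⟩
  obtain ⟨x, -, hx⟩ := isCompact_Icc.exists_isMinOn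
    (nonempty_Icc.mpr (by linarith : -T ≤ T)) hv.continuous.continuousOn
  obtain ⟨y, -, hy⟩ := isCompact_Icc.exists_isMaxOn
    (nonempty_Icc.mpr (by linarith : -T ≤ T)) hv.continuous.continuousOn
  have hmem (s : ℝ) (hs : s ∈ Ioo (-T) T) : v s ∈ Icc (v x) (v y) :=
    ⟨hx (Ioo_subset_Icc_self hs), hy (Ioo_subset_Icc_self hs)⟩
  obtain ⟨K, hK⟩ := (hg.mono fun z hz ↦ (hpos x).trans_le hz.1).exists_lipschitzOnWith
    one_ne_zero (convex_Icc (v x) (v y)) isCompact_Icc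
  have hlip : LipschitzOnWith (max 1 (K * 1)) (fun p : ℝ × ℝ ↦ (p.2, g p.1))
      (Icc (v x) (v y) ×ˢ univ) :=
    LipschitzWith.prod_snd.lipschitzOnWith.prodMk
      (hK.comp LipschitzWith.prod_fst.lipschitzOnWith fun p hp ↦ hp.1)
  have hd (s : ℝ) : HasDerivAt v (deriv v s) s :=
    (hv.differentiable two_ne_zero s).hasDerivAt
  have hdd (s : ℝ) : HasDerivAt (deriv v) (g (v s)) s := by
    rw [← hode s]
    exact ((contDiff_succ_iff_deriv (n := 1).mp hv).2.2.differentiable one_ne_zero s).hasDerivAt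
  have hflow : EqOn (fun s ↦ (v (-s), -deriv v (-s))) (fun s ↦ (v s, deriv v s)) (Ioo (-T) T) := by
    refine ODE_solution_unique_of_mem_Ioo (v := fun _ p ↦ (p.2, g p.1)) (t₀ := 0)
      (fun _ _ ↦ hlip) (by simpa using hT0) (fun s hs ↦ ⟨?_, ?_, mem_univ _⟩)
      (fun s hs ↦ ⟨(hd s).prodMk (hdd s), hmem s hs, mem_univ _⟩) (by simp [h0])
    · have h1 := (hd (-s)).comp s (hasDerivAt_neg s)
      have h2 := ((hdd (-s)).comp s (hasDerivAt_neg s)).neg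
      simpa using! h1.prodMk h2
    · exact hmem (-s) ⟨by linarith [hs.2], by linarith [hs.1]⟩
  exact congrArg Prod.fst (hflow htT)

/-- Delaunay solutions are even. -/
theorem delaunay_even (n k : ℕ) (hk : 2 ≤ 2 * k) (hkn : 2 * k < n)
    (H₀ : ℝ) (hH₀ : 0 < H₀) (hH₁ : H₀ < Hmax n k)
    (v : ℝ → ℝ) (hsol : DelSol n k H₀ v) :
    ∀ t : ℝ, v (-t) = v t := by
  obtain ⟨hsmooth, hpos, hode, h0, -, hH⟩ := hsol
  have hk0 : k ≠ 0 := by omega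
  have hα : alp n k ≠ 0 := by
    have : (2 * k : ℝ) < n := by exact_mod_cast hkn
    have : (0 : ℝ) < k := by exact_mod_cast Nat.pos_of_ne_zero hk0
    exact (div_pos (by linarith) (by linarith)).ne'
  have hpow (t : ℝ) : hDel n k v t ^ k = H₀ + v t ^ qe n k := by
    rw [← hH t, HDel]
    ring
  have hcont : Continuous (hDel n k v) := by
    have := hsmooth.continuous
    have := hsmooth.continuous_deriv (by simp)
    unfold hDel
    fun_prop
  have hsum (x : ℝ) (hx : 0 < x) : 0 < H₀ + x ^ qe n k := by positivity
  have hne (t : ℝ) : hDel n k v t ≠ 0 := by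
    intro h
    have := hsum _ (hpos t)
    rw [← hpow t, h, zero_pow hk0] at this
    exact this.false
  have hh (t : ℝ) : 0 < hDel n k v t :=
    isPreconnected_univ.lt_of_ne hcont.continuousOn (fun t _ ↦ hne t)
      ⟨0, mem_univ 0, by simp [hDel, h0, hpos 0]⟩ (mem_univ t)
  refine even_of_deriv_deriv_eq
    (g := fun x ↦ alp n k ^ 2 * (x - (n : ℝ) / ((n : ℝ) - 2 * (k : ℝ)) * x ^ (qe n k - 1) /
      ((H₀ + x ^ qe n k) ^ ((k : ℝ)⁻¹)) ^ (k - 1)))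
    (fun x hx ↦ ?_) (contDiff_infty.mp hsmooth 2) hpos (fun t ↦ ?_) h0
  · have hx' : x ≠ 0 := (mem_Ioi.mp hx).ne'
    have hS : H₀ + x ^ qe n k ≠ 0 := (hsum x hx).ne'
    have hD : ((H₀ + x ^ qe n k) ^ ((k : ℝ)⁻¹)) ^ (k - 1) ≠ 0 :=
      pow_ne_zero _ (rpow_pos_of_pos (hsum x hx) _).ne'
    exact (contDiffAt_const.mul (contDiffAt_id.sub
      ((contDiffAt_const.mul (contDiffAt_rpow_const_of_ne hx')).div
        (((contDiffAt_const.add (contDiffAt_rpow_const_of_ne hx')).rpow_const_of_ne hS).pow _)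
        hD))).contDiffWithinAt
  · have hroot : (H₀ + v t ^ qe n k) ^ ((k : ℝ)⁻¹) = hDel n k v t := by
      rw [← hpow t, pow_rpow_inv_natCast (hh t).le hk0]
    simp only [hroot]
    rw [← hode t, mul_div_cancel_left₀ _ (pow_ne_zero _ (hne t))]
    field_simp
    ring
end
end
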